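/- Let π : ℝ → [0, ∞) be symmetric about 0, continuously differentiable and nonincreasing on (0, ∞), with π(t) → 0 as t → ∞. Then for every nonzero real θ: π(1/θ)/θ² = ∫₀^∞ (1/(2t·θ²))·1{|θ| > 1/t} · (−2t·π′(t)) dt. That is, the reciprocal of any symmetric monotone density kernel π decomposes as a scale mixture of inverse uniform (double Pareto) kernels π(θ | t) = (1/(2t·θ²))·1{|θ| > 1/t} with mixing weight h(t) = −2t·π′(t) (the unified reciprocalization formula (6) for shrinkage densities). -/

import Mathlib

open MeasureTheory Real Set Filter

/-- The unified reciprocalization formula (6) for shrinkage densities: the reciprocal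
of any symmetric monotone density kernel π decomposes as a scale mixture of inverse
uniform (double Pareto) kernels with mixing weight h(t) = −2t·π′(t). -/
theorem stmt_10 (p : ℝ → ℝ)
    (hnonneg : ∀ x : ℝ, 0 ≤ p x)
    (hsymm : ∀ x : ℝ, p (-x) = p x)
    (hsmooth : ContDiffOn ℝ 1 p (Ioi 0))
    (hanti : AntitoneOn p (Ioi 0))
    (htail : Tendsto p atTop (nhds 0)) :
    ∀ θ : ℝ, θ ≠ 0 →
      p (1 / θ) / θ ^ 2 =
        ∫ t in Ioi (0 : ℝ),
          ((1 / (2 * t * θ ^ 2)) * (if 1 / t < |θ| then (1 : ℝ) else 0)) *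
            (-2 * t * deriv p t) := by
  intro θ hθ
  have habs : 0 < |θ| := abs_pos.mpr hθ
  have ha : 0 < 1 / |θ| := by positivity
  have hp : p (1 / θ) = p (1 / |θ|) := by
    rcases abs_choice θ with h | h
    · rw [h]
    · rw [h, one_div_neg_eq_neg_one_div, hsymm]
  have hd : ∀ x ∈ Ioi (0 : ℝ), HasDerivAt p (deriv p x) x := fun x hx =>
    ((hsmooth.differentiableOn one_ne_zero).differentiableAt (Ioi_mem_nhds hx)).hasDerivAt
  have hneg : ∀ x ∈ Ioi (0 : ℝ), deriv p x ≤ 0 := by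
    intro x hx
    rw [← derivWithin_of_mem_nhds (Ioi_mem_nhds hx)]
    exact hanti.derivWithin_nonpos
  have key : ∫ x in Ioi (1 / |θ|), deriv p x = 0 - p (1 / |θ|) :=
    integral_Ioi_of_hasDerivAt_of_nonpos' (fun x hx => hd x (lt_of_lt_of_le ha hx))
      (fun x hx => hneg x (lt_trans ha hx)) htail
  have hint : ∀ t ∈ Ioi (0 : ℝ),
      ((1 / (2 * t * θ ^ 2)) * (if 1 / t < |θ| then (1 : ℝ) else 0)) * (-2 * t * deriv p t)
        = (Ioi (1 / |θ|)).indicator (fun t => (-1 / θ ^ 2) * deriv p t) t := by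
    intro t ht
    have ht0 : (0 : ℝ) < t := ht
    by_cases h : 1 / t < |θ|
    · have h2 : t ∈ Ioi (1 / |θ|) := (one_div_lt ht0 habs).mp h
      rw [indicator_of_mem h2, if_pos h]
      field_simp
    · have h2 : t ∉ Ioi (1 / |θ|) := fun h3 => h ((one_div_lt ht0 habs).mpr h3)
      rw [indicator_of_notMem h2, if_neg h]
      ring
  rw [setIntegral_congr_fun measurableSet_Ioi hint, setIntegral_indicator measurableSet_Ioi,
    inter_eq_self_of_subset_right (Ioi_subset_Ioi ha.le), integral_const_mul, key, hp]
  ring
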